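/- arXiv:1312.4354 — 2 statements merged into one kernel-verified Lean document; each statement's English description precedes it below -/
import Mathlib

section
/- Let v₁, v₂, v₃ ∈ ℝ³ be affinely independent and let h₂ be the height vector of the triangle at v₂, i.e. h₂ = q₂ − v₂ where q₂ is the orthogonal projection of v₂ onto the line through v₁ and v₃, and similarly h₃ = q₃ − v₃ with q₃ the orthogonal projection of v₃ onto the line through v₁ and v₂. Given values F₁, F₂, F₃ ∈ ℝ, define G = (F₁ − F₂) · h₂/|h₂|² + (F₁ − F₃) · h₃/|h₃|². Then G lies in the plane of the triangle (G ∈ span{v₂ − v₁, v₃ − v₁}) and satisfies G · (v₁ − v₂) = F₁ − F₂ and G · (v₁ − v₃) = F₁ − F₃; hence G is the (tangential) gradient of the unique affine function on the plane of the triangle taking the values F₁, F₂, F₃ at v₁, v₂, v₃. -/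
open scoped RealInnerProductSpace

/-- Correctness of the height-vector formula for the tangential gradient of a linear
interpolant on a triangle: with `h₂ = q₂ - v₂`, `h₃ = q₃ - v₃` the height vectors (where
`q₂`, `q₃` are the orthogonal projections of `v₂`, `v₃` onto the opposite sides), the vector
`G = (F₁ - F₂) h₂/|h₂|² + (F₁ - F₃) h₃/|h₃|²` lies in the plane of the triangle and
satisfies `G · (v₁ - v₂) = F₁ - F₂` and `G · (v₁ - v₃) = F₁ - F₃`; hence it is the
gradient of the unique affine function on the plane of the triangle taking the values
`F₁, F₂, F₃` at the vertices. -/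
theorem height_vector_gradient_formula
    (v₁ v₂ v₃ : EuclideanSpace ℝ (Fin 3))
    (hv : AffineIndependent ℝ ![v₁, v₂, v₃])
    (q₂ q₃ : EuclideanSpace ℝ (Fin 3))
    (hq₂line : ∃ t : ℝ, q₂ = v₁ + t • (v₃ - v₁))
    (hq₂perp : ⟪v₂ - q₂, v₃ - v₁⟫ = 0)
    (hq₃line : ∃ t : ℝ, q₃ = v₁ + t • (v₂ - v₁))
    (hq₃perp : ⟪v₃ - q₃, v₂ - v₁⟫ = 0)
    (h₂ h₃ : EuclideanSpace ℝ (Fin 3)) (hh₂ : h₂ = q₂ - v₂) (hh₃ : h₃ = q₃ - v₃)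
    (F₁ F₂ F₃ : ℝ)
    (G : EuclideanSpace ℝ (Fin 3))
    (hG : G = ((F₁ - F₂) / ‖h₂‖ ^ 2) • h₂ + ((F₁ - F₃) / ‖h₃‖ ^ 2) • h₃) :
    G ∈ Submodule.span ℝ {v₂ - v₁, v₃ - v₁} ∧
      ⟪G, v₁ - v₂⟫ = F₁ - F₂ ∧ ⟪G, v₁ - v₃⟫ = F₁ - F₃ := by
  obtain ⟨t, ht⟩ := hq₂line
  obtain ⟨s, hs⟩ := hq₃line
  rw [affineIndependent_iff_not_collinear_set,
    collinear_iff_of_mem (p₀ := v₁) (by simp)] at hv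
  have e2 : h₂ = t • (v₃ - v₁) - (v₂ - v₁) := by rw [hh₂, ht]; abel
  have e3 : h₃ = s • (v₂ - v₁) - (v₃ - v₁) := by rw [hh₃, hs]; abel
  have n2 : h₂ ≠ 0 := by
    intro h0
    rw [h0] at e2
    apply hv
    refine ⟨v₃ - v₁, fun p hp => ?_⟩
    rcases hp with rfl | rfl | rfl
    · exact ⟨0, by simp⟩
    · exact ⟨t, by rw [sub_eq_zero.mp e2.symm]; simp⟩
    · exact ⟨1, by simp⟩
  have n3 : h₃ ≠ 0 := by
    intro h0
    rw [h0] at e3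
    apply hv
    refine ⟨v₂ - v₁, fun p hp => ?_⟩
    rcases hp with rfl | rfl | rfl
    · exact ⟨0, by simp⟩
    · exact ⟨1, by simp⟩
    · exact ⟨s, by rw [sub_eq_zero.mp e3.symm]; simp⟩
  have p2 : ⟪h₂, v₃ - v₁⟫ = 0 := by
    rw [hh₂, ← neg_sub, inner_neg_left, hq₂perp, neg_zero]
  have p3 : ⟪h₃, v₂ - v₁⟫ = 0 := by
    rw [hh₃, ← neg_sub, inner_neg_left, hq₃perp, neg_zero]
  have m2 : ⟪h₂, v₁ - v₂⟫ = ‖h₂‖ ^ 2 := by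
    have : v₁ - v₂ = h₂ - t • (v₃ - v₁) := by rw [e2]; abel
    rw [this, inner_sub_right, inner_smul_right, p2, real_inner_self_eq_norm_sq]; ring
  have m3 : ⟪h₃, v₁ - v₃⟫ = ‖h₃‖ ^ 2 := by
    have : v₁ - v₃ = h₃ - s • (v₂ - v₁) := by rw [e3]; abel
    rw [this, inner_sub_right, inner_smul_right, p3, real_inner_self_eq_norm_sq]; ring
  have o2 : ⟪h₂, v₁ - v₃⟫ = 0 := by rw [← neg_sub, inner_neg_right, p2, neg_zero]
  have o3 : ⟪h₃, v₁ - v₂⟫ = 0 := by rw [← neg_sub, inner_neg_right, p3, neg_zero]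
  have k2 : ‖h₂‖ ^ 2 ≠ 0 := pow_ne_zero _ (norm_ne_zero_iff.mpr n2)
  have k3 : ‖h₃‖ ^ 2 ≠ 0 := pow_ne_zero _ (norm_ne_zero_iff.mpr n3)
  have ma : v₂ - v₁ ∈ Submodule.span ℝ {v₂ - v₁, v₃ - v₁} :=
    Submodule.subset_span (by simp)
  have mb : v₃ - v₁ ∈ Submodule.span ℝ {v₂ - v₁, v₃ - v₁} :=
    Submodule.subset_span (by simp)
  refine ⟨?_, ?_, ?_⟩
  · rw [hG]
    refine Submodule.add_mem _ (Submodule.smul_mem _ _ ?_) (Submodule.smul_mem _ _ ?_)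
    · rw [e2]; exact Submodule.sub_mem _ (Submodule.smul_mem _ _ mb) ma
    · rw [e3]; exact Submodule.sub_mem _ (Submodule.smul_mem _ _ ma) mb
  · rw [hG, inner_add_left, real_inner_smul_left, real_inner_smul_left, m2, o3,
      div_mul_cancel₀ _ k2, mul_zero, add_zero]
  · rw [hG, inner_add_left, real_inner_smul_left, real_inner_smul_left, m3, o2,
      div_mul_cancel₀ _ k3, mul_zero, zero_add]
end

section
/- Let m, n ∈ ℕ and let P, Q : ℝ³ → ℝ be harmonic polynomials homogeneous of degrees n and m respectively, with radially constant extensions P̄(x) = |x|^{-n} P(x) and Q̄(x) = |x|^{-m} Q(x) of their restrictions to the unit sphere. Then the type-2 and type-3 vector spherical harmonics are mutually orthogonal in L²(S², TS²): ∫_{S²} ∇P̄(x) · (∇Q̄(x) × x) dℋ²(x) = 0, where × is the cross product of ℝ³ and ν(x) = x is the outward unit normal of S². -/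
open scoped BigOperators RealInnerProductSpace
open MeasureTheory

/-- Evaluation of a polynomial in three variables at a point of Euclidean `ℝ³`. -/
noncomputable def pEval (P : MvPolynomial (Fin 3) ℝ) (x : EuclideanSpace ℝ (Fin 3)) : ℝ :=
  MvPolynomial.eval (fun i => x i) P

/-- The Euclidean Laplacian of a scalar function on Euclidean `ℝ³`. -/
noncomputable def elap (f : EuclideanSpace ℝ (Fin 3) → ℝ) (x : EuclideanSpace ℝ (Fin 3)) : ℝ :=
  ∑ i : Fin 3, fderiv ℝ (fun y => fderiv ℝ f y (EuclideanSpace.single i 1)) x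
    (EuclideanSpace.single i 1)

/-- The cross product on Euclidean `ℝ³`. -/
noncomputable def ecross (u v : EuclideanSpace ℝ (Fin 3)) : EuclideanSpace ℝ (Fin 3) :=
  (EuclideanSpace.equiv (Fin 3) ℝ).symm
    ![u 1 * v 2 - u 2 * v 1, u 2 * v 0 - u 0 * v 2, u 0 * v 1 - u 1 * v 0]

abbrev E3 := EuclideanSpace ℝ (Fin 3)

lemma pEval_hasFDerivAt (P : MvPolynomial (Fin 3) ℝ) (x : E3) :
    HasFDerivAt (pEval P)
      (∑ i : Fin 3, pEval (MvPolynomial.pderiv i P) x • (EuclideanSpace.proj i : E3 →L[ℝ] ℝ)) x := by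
  induction P using MvPolynomial.induction_on with
  | C a =>
    have : pEval (MvPolynomial.C a) = fun _ => a := by ext y; simp [pEval]
    rw [this]
    simpa [pEval] using hasFDerivAt_const a x
  | add p q hp hq =>
    have : pEval (p + q) = fun y => pEval p y + pEval q y := by ext y; simp [pEval]
    rw [this]
    refine (hp.add hq).congr_fderiv ?_
    simp [pEval, add_smul, Finset.sum_add_distrib]
  | mul_X p j hp =>
    have : pEval (p * MvPolynomial.X j) = fun y => pEval p y * (EuclideanSpace.proj j : E3 →L[ℝ] ℝ) y := by
      ext y; simp [pEval]
    rw [this]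
    refine (hp.mul (EuclideanSpace.proj j : E3 →L[ℝ] ℝ).hasFDerivAt).congr_fderiv ?_
    ext v
    fin_cases j <;> simp [pEval, MvPolynomial.pderiv_X, Fin.sum_univ_three, Pi.single_apply] <;> ring

lemma pEval_continuous (P : MvPolynomial (Fin 3) ℝ) : Continuous (pEval P) :=
  continuous_iff_continuousAt.2 fun x => (pEval_hasFDerivAt P x).continuousAt

lemma pderiv_swap (i j : Fin 3) (P : MvPolynomial (Fin 3) ℝ) :
    MvPolynomial.pderiv i (MvPolynomial.pderiv j P) =
      MvPolynomial.pderiv j (MvPolynomial.pderiv i P) := by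
  induction P using MvPolynomial.induction_on with
  | C a => simp
  | add p q hp hq => simp [hp, hq]
  | mul_X p k hp =>
    simp only [MvPolynomial.pderiv_mul, map_add, hp, MvPolynomial.pderiv_X, Pi.single_apply]
    split_ifs <;> simp <;> ring

noncomputable def gradP (P : MvPolynomial (Fin 3) ℝ) (x : E3) : E3 :=
  WithLp.toLp 2 fun i => pEval (MvPolynomial.pderiv i P) x

lemma gradient_quot (P : MvPolynomial (Fin 3) ℝ) (n : ℕ) (x : E3) (hx : ‖x‖ = 1) :
    ∃ c : ℝ, gradient (fun y => pEval P y / ‖y‖ ^ n) x = gradP P x + c • x := by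
  have h1 : HasFDerivAt (fun y : E3 => ‖y‖) (innerSL ℝ x) x := by
    have h := (hasStrictFDerivAt_norm_sq x).hasFDerivAt.sqrt (by simp [hx])
    simp only [Real.sqrt_sq (norm_nonneg _)] at h
    refine h.congr_fderiv ?_
    rw [hx]
    ext v
    simp
  have h2 := h1.pow n
  have h3 := (pEval_hasFDerivAt P x).mul
    ((hasDerivAt_inv (x := ‖x‖ ^ n) (by simp [hx])).comp_hasFDerivAt x h2)
  refine ⟨-(pEval P x * n), HasGradientAt.gradient ?_⟩
  rw [hasGradientAt_iff_hasFDerivAt]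
  simp only [div_eq_mul_inv]
  refine HasFDerivAt.congr_fderiv h3 ?_
  ext v
  simp [hx, gradP, inner_add_left, inner_smul_left, PiLp.inner_apply, Fin.sum_univ_three]
  ring

noncomputable def rotL (i j : Fin 3) (t : ℝ) : E3 →ₗ[ℝ] E3 where
  toFun x := WithLp.toLp 2 fun l => if l = i then Real.cos t * x i - Real.sin t * x j
    else if l = j then Real.sin t * x i + Real.cos t * x j else x l
  map_add' x y := by
    ext l; simp; split_ifs <;> ring
  map_smul' c x := by
    ext l; simp; split_ifs <;> ring

lemma rotL_norm (i j : Fin 3) (h : i ≠ j) (t : ℝ) (x : E3) : ‖rotL i j t x‖ = ‖x‖ := by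
  rw [EuclideanSpace.norm_eq, EuclideanSpace.norm_eq]
  congr 1
  have hs := Real.sin_sq_add_cos_sq t
  have key (a b : ℝ) : (Real.cos t * a - Real.sin t * b)^2 + (Real.sin t * a + Real.cos t * b)^2
      = a^2 + b^2 := by linear_combination (a^2+b^2) * hs
  have := key (x i) (x j)
  fin_cases i <;> fin_cases j <;>
    simp [rotL, Fin.sum_univ_three] at h this ⊢ <;> linarith

noncomputable def rotE (i j : Fin 3) (h : i ≠ j) (t : ℝ) : E3 ≃ₗᵢ[ℝ] E3 :=
  LinearIsometry.toLinearIsometryEquiv ⟨rotL i j t, rotL_norm i j h t⟩ rfl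

noncomputable def DP (i j : Fin 3) (P : MvPolynomial (Fin 3) ℝ) : MvPolynomial (Fin 3) ℝ :=
  MvPolynomial.X i * MvPolynomial.pderiv j P - MvPolynomial.X j * MvPolynomial.pderiv i P

lemma rot_deriv (i j : Fin 3) (h : i ≠ j) (P : MvPolynomial (Fin 3) ℝ) (x : E3) (t : ℝ) :
    HasDerivAt (fun t => pEval P (rotL i j t x)) (pEval (DP i j P) (rotL i j t x)) t := by
  have hc : HasDerivAt (fun t => rotL i j t x) (WithLp.toLp 2 fun l =>
      if l = i then -Real.sin t * x i - Real.cos t * x j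
      else if l = j then Real.cos t * x i - Real.sin t * x j else 0) t := by
    rw [hasDerivAt_iff_hasFDerivAt, ← hasFDerivWithinAt_univ, hasFDerivWithinAt_piLp]
    intro l
    rw [hasFDerivWithinAt_univ]
    suffices HasDerivAt (fun t => rotL i j t x l) (if l = i then -Real.sin t * x i - Real.cos t * x j
      else if l = j then Real.cos t * x i - Real.sin t * x j else 0) t by
      refine this.hasFDerivAt.congr_fderiv ?_
      ext
      simp
    simp only [rotL, LinearMap.coe_mk, AddHom.coe_mk]
    split_ifs
    · exact ((Real.hasDerivAt_cos t).mul_const _).sub ((Real.hasDerivAt_sin t).mul_const _)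
    · refine (((Real.hasDerivAt_sin t).mul_const (x i)).add
        ((Real.hasDerivAt_cos t).mul_const (x j))).congr_deriv ?_
      ring
    · exact hasDerivAt_const _ _
  refine ((pEval_hasFDerivAt P (rotL i j t x)).comp_hasDerivAt t hc).congr_deriv ?_
  fin_cases i <;> fin_cases j <;>
    simp [DP, pEval, rotL, Fin.sum_univ_three] at h ⊢ <;> ring

lemma sphere_finite : (μH[2] : Measure E3) (Metric.sphere 0 1) < ⊤ := by
  let g : (Fin 2 → ℝ) → E3 := fun v => WithLp.toLp 2
    ![Real.cos (v 0) * Real.cos (v 1), Real.cos (v 0) * Real.sin (v 1), Real.sin (v 0)]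
  have hg : ContDiff ℝ 1 g := by
    rw [contDiff_piLp]
    intro i
    fin_cases i <;> simp [g] <;> fun_prop
  obtain ⟨K, hK⟩ := hg.contDiffOn.exists_lipschitzOnWith one_ne_zero (convex_closedBall (0 : Fin 2 → ℝ) 10)
    (isCompact_closedBall _ _)
  have hsub : Metric.sphere (0 : E3) 1 ⊆ g '' Metric.closedBall 0 10 := by
    intro x hx
    have hx1 : ‖x‖ = 1 := by simpa using hx
    have hsum : x 0 ^ 2 + x 1 ^ 2 + x 2 ^ 2 = 1 := by
      have := EuclideanSpace.norm_sq_eq x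
      simp [hx1, Fin.sum_univ_three] at this
      linarith
    have hcos : Real.cos (Real.arcsin (x 2)) = ‖(⟨x 0, x 1⟩ : ℂ)‖ := by
      rw [Real.cos_arcsin, Complex.norm_def, Complex.normSq_mk]
      congr 1; linarith
    refine ⟨![Real.arcsin (x 2), Complex.arg ⟨x 0, x 1⟩], ?_, ?_⟩
    · rw [mem_closedBall_zero_iff, pi_norm_le_iff_of_nonneg (by norm_num)]
      have hp := Real.pi_lt_four
      intro i
      fin_cases i
      · simp [abs_le]
        constructor
        · linarith [Real.neg_pi_div_two_le_arcsin (x 2)]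
        · linarith [Real.arcsin_le_pi_div_two (x 2)]
      · simp
        linarith [Complex.abs_arg_le_pi ⟨x 0, x 1⟩]
    · ext i
      fin_cases i
      · simp [g, hcos, Complex.norm_mul_cos_arg]
      · simp [g, hcos, Complex.norm_mul_sin_arg]
      · simp [g]
        apply Real.sin_arcsin <;> nlinarith [sq_nonneg (x 0), sq_nonneg (x 1)]
  refine (measure_mono hsub).trans_lt ((hK.hausdorffMeasure_image_le (by norm_num)).trans_lt ?_)
  have hv : (μH[2] : Measure (Fin 2 → ℝ)) = volume := by
    have := hausdorffMeasure_pi_real (ι := Fin 2)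
    simpa using this
  rw [hv]
  exact ENNReal.mul_lt_top (ENNReal.rpow_lt_top_of_nonneg (by norm_num) ENNReal.coe_ne_top)
    (isCompact_closedBall _ _).measure_lt_top

lemma integrable_pEval (P : MvPolynomial (Fin 3) ℝ) :
    IntegrableOn (pEval P) (Metric.sphere (0 : E3) 1) μH[2] :=
  (pEval_continuous P).continuousOn.integrableOn_of_subset_isCompact (isCompact_sphere _ _)
    (isCompact_sphere _ _).measurableSet subset_rfl sphere_finite.ne

lemma integral_DP (i j : Fin 3) (h : i ≠ j) (P : MvPolynomial (Fin 3) ℝ) :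
    ∫ x in Metric.sphere (0 : E3) 1, pEval (DP i j P) x ∂μH[2] = 0 := by
  haveI : IsFiniteMeasure ((μH[2] : Measure E3).restrict (Metric.sphere 0 1)) :=
    ⟨by simpa using sphere_finite⟩
  have hinv (t : ℝ) : ∫ x in Metric.sphere (0 : E3) 1, pEval P (rotL i j t x) ∂μH[2]
      = ∫ x in Metric.sphere (0 : E3) 1, pEval P x ∂μH[2] := by
    have hm := (rotE i j h t).toIsometryEquiv.measurePreserving_hausdorffMeasure 2
    have := hm.setIntegral_preimage_emb
      (rotE i j h t).toHomeomorph.measurableEmbedding (pEval P) (Metric.sphere 0 1)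
    rw [← this]
    have hpre : (rotE i j h t).toIsometryEquiv ⁻¹' (Metric.sphere 0 1) = Metric.sphere 0 1 := by
      ext x; simp
    rw [hpre]
    rfl
  obtain ⟨C, hC⟩ := (isCompact_sphere (0 : E3) 1).exists_bound_of_continuousOn
    (pEval_continuous (DP i j P)).continuousOn
  have hcont (t : ℝ) : Continuous (rotL i j t) := (rotL i j t).continuous_of_finiteDimensional
  have h0 : rotL i j 0 = LinearMap.id := by
    ext x l; simp [rotL]; split_ifs <;> simp_all
  have key := (hasDerivAt_integral_of_dominated_loc_of_deriv_le
    (μ := (μH[2] : Measure E3).restrict (Metric.sphere 0 1)) (x₀ := (0:ℝ)) (s := Set.univ)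
    (F := fun t x => pEval P (rotL i j t x))
    (F' := fun t x => pEval (DP i j P) (rotL i j t x)) (bound := fun _ => C)
    Filter.univ_mem
    (.of_forall fun t => ((pEval_continuous P).comp (hcont t)).aestronglyMeasurable)
    (by simp only [h0]; exact integrable_pEval P)
    ((pEval_continuous _).comp (hcont 0)).aestronglyMeasurable
    (by
      filter_upwards [ae_restrict_mem (isCompact_sphere _ _).measurableSet] with x hx t _
      apply hC
      simpa [rotL_norm i j h t] using hx)
    (integrable_const C)
    (.of_forall fun x t _ => rot_deriv i j h P x t)).2
  simp only [hinv, h0, LinearMap.id_apply] at key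
  exact key.unique (hasDerivAt_const _ _)

/-- For harmonic polynomials `P`, `Q` homogeneous of degrees `n`, `m`, with radially constant
extensions `P̄(x) = |x|⁻ⁿ P(x)`, `Q̄(x) = |x|⁻ᵐ Q(x)`, the associated type-2 and type-3
vector spherical harmonics are mutually orthogonal in `L²(S², TS²)`:
`∫_{S²} ∇P̄ · (∇Q̄ × ν) dℋ² = 0`, where `ν(x) = x` is the outward unit normal. -/
theorem vector_spherical_harmonics_type2_type3_orthogonal
    (n m : ℕ) (P Q : MvPolynomial (Fin 3) ℝ)
    (hPhom : P.IsHomogeneous n) (hQhom : Q.IsHomogeneous m)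
    (hPharm : ∀ x, elap (pEval P) x = 0) (hQharm : ∀ x, elap (pEval Q) x = 0) :
    ∫ x in Metric.sphere (0 : EuclideanSpace ℝ (Fin 3)) 1,
        ⟪gradient (fun y => pEval P y / ‖y‖ ^ n) x,
          ecross (gradient (fun y => pEval Q y / ‖y‖ ^ m) x) x⟫ ∂(μH[2]) = 0 := by

  have hpt : ∀ x ∈ Metric.sphere (0 : E3) 1,
      ⟪gradient (fun y => pEval P y / ‖y‖ ^ n) x,
          ecross (gradient (fun y => pEval Q y / ‖y‖ ^ m) x) x⟫ =
      pEval (DP 1 2 (P * MvPolynomial.pderiv 0 Q)) x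
        + pEval (DP 2 0 (P * MvPolynomial.pderiv 1 Q)) x
        + pEval (DP 0 1 (P * MvPolynomial.pderiv 2 Q)) x := by
    intro x hx
    have hx1 : ‖x‖ = 1 := by simpa using hx
    obtain ⟨c, hc⟩ := gradient_quot P n x hx1
    obtain ⟨d, hd⟩ := gradient_quot Q m x hx1
    rw [hc, hd]
    have e1 := pderiv_swap 1 0 Q
    have e2 := pderiv_swap 2 0 Q
    have e3 := pderiv_swap 2 1 Q
    simp [ecross, gradP, PiLp.inner_apply, Fin.sum_univ_three, DP, pEval,
      MvPolynomial.pderiv_mul, e1, e2, e3]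
    ring
  rw [setIntegral_congr_fun (isCompact_sphere _ _).measurableSet hpt]
  have h3 := fun P => integrable_pEval P
  unfold IntegrableOn at h3
  rw [integral_add (by exact (h3 _).add (h3 _)) (h3 _), integral_add (h3 _) (h3 _),
    integral_DP _ _ (by decide), integral_DP _ _ (by decide), integral_DP _ _ (by decide)]
  simp
end
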